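/- arXiv:1401.6387 — 6 statements merged into one kernel-verified Lean document; each statement's English description precedes it below -/
import Mathlib

section
/- Every squared tiling of the 13×13 square that contains a square of side length 11 consists of at least 16 squares, and there exists such a tiling with exactly 16 squares; hence the minimum number of tiles in a squared tiling of the 13×13 square using at least one 11×11 square equals 16. -/
/-- A squared tiling of the `n × n` square: a finite set of triples `(x, y, h)`
representing an `h × h` square with upper-left corner at cell `(x, y)`,
where `1 ≤ h ≤ n - 1`, the square lies inside the board, and every cell
`(i, j)` with `i, j < n` is covered by exactly one square of the tiling. -/
def IsSquaredTiling (n : ℕ) (T : Finset (ℕ × ℕ × ℕ)) : Prop :=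
  (∀ t ∈ T, 1 ≤ t.2.2 ∧ t.2.2 ≤ n - 1 ∧ t.1 + t.2.2 ≤ n ∧ t.2.1 + t.2.2 ≤ n) ∧
  (∀ i j : ℕ, i < n → j < n →
    ∃! t : ℕ × ℕ × ℕ, t ∈ T ∧
      t.1 ≤ i ∧ i < t.1 + t.2.2 ∧ t.2.1 ≤ j ∧ j < t.2.1 + t.2.2)

/-- `s n` is the minimum number of squares in a squared tiling of the
`n × n` square. -/
noncomputable def s (n : ℕ) : ℕ :=
  sInf {k | ∃ T : Finset (ℕ × ℕ × ℕ), IsSquaredTiling n T ∧ T.card = k}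

def rr (a : ℕ) : ℕ := if a = 0 then 11 else if a = 2 then 1 else 13

def covB (x y h i j : ℕ) : Bool :=
  Nat.ble x i && (Nat.ble (i + 1) (x + h) && (Nat.ble y j && Nat.ble (j + 1) (y + h)))

def wt (a b i j : ℕ) : ℤ :=
  bif covB a b 11 i j then (bif Nat.beq i a && Nat.beq j b then 1 else 0)
  else bif (Nat.beq i (rr a) && Nat.beq (j % 2) 1) || (Nat.beq j (rr b) && Nat.beq (i % 2) 1)
    then -2 else 1

def tw (a b x y h : ℕ) : ℤ :=
  ∑ i ∈ Finset.range 13, ∑ j ∈ Finset.range 13, bif covB x y h i j then wt a b i j else 0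

theorem tw_big : ∀ a < 3, ∀ b < 3, tw a b a b 11 ≤ 1 := by decide +kernel

set_option synthInstance.maxHeartbeats 400000 in
set_option synthInstance.maxSize 10000 in
theorem tw_one : ∀ a < 3, ∀ b < 3, ∀ x < 13, ∀ y < 13, ∀ h < 3,
    x + h ≤ 13 → y + h ≤ 13 → ¬ (x < a + 11 ∧ a < x + h ∧ y < b + 11 ∧ b < y + h) → tw a b x y h ≤ 1 := by
  decide +kernel

theorem wt_total : ∀ a < 3, ∀ b < 3,
    16 ≤ ∑ i ∈ Finset.range 13, ∑ j ∈ Finset.range 13, wt a b i j := by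
  decide +kernel

theorem covB_iff (x y h i j : ℕ) :
    covB x y h i j = true ↔ x ≤ i ∧ i < x + h ∧ y ≤ j ∧ j < y + h := by
  simp only [covB, Bool.and_eq_true, Nat.ble_eq]
  omega

theorem lower (T : Finset (ℕ × ℕ × ℕ)) (hT : IsSquaredTiling 13 T)
    (hb : ∃ t ∈ T, t.2.2 = 11) : 16 ≤ T.card := by
  obtain ⟨⟨a, b, c⟩, hm, hc⟩ := hb
  simp only at hc
  subst hc
  obtain ⟨h1, h2⟩ := hT
  have hbd := h1 _ hm
  simp only at hbd
  have ha : a < 3 := by omega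
  have hb : b < 3 := by omega
  have key : ∑ t ∈ T, tw a b t.1 t.2.1 t.2.2
      = ∑ i ∈ Finset.range 13, ∑ j ∈ Finset.range 13, wt a b i j := by
    unfold tw
    rw [Finset.sum_comm]
    refine Finset.sum_congr rfl fun i hi => ?_
    rw [Finset.sum_comm]
    refine Finset.sum_congr rfl fun j hj => ?_
    obtain ⟨t, ⟨htT, ht⟩, hu⟩ := h2 i j (Finset.mem_range.1 hi) (Finset.mem_range.1 hj)
    rw [Finset.sum_eq_single_of_mem t htT]
    · rw [(covB_iff _ _ _ _ _).2 ht]; rfl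
    · intro u huT hne
      have : covB u.1 u.2.1 u.2.2 i j = false := by
        rw [Bool.eq_false_iff]
        intro hcv
        exact hne (hu u ⟨huT, (covB_iff _ _ _ _ _).1 hcv⟩)
      rw [this]; rfl
  have bound : ∀ t ∈ T, tw a b t.1 t.2.1 t.2.2 ≤ 1 := by
    rintro ⟨x, y, h⟩ ht
    have hx := h1 _ ht
    simp only at hx ⊢
    by_cases hov : x < a + 11 ∧ a < x + h ∧ y < b + 11 ∧ b < y + h
    · obtain ⟨u, _, hu⟩ := h2 (max a x) (max b y) (by omega) (by omega)
      have e1 := hu (x, y, h) ⟨ht, by simp only; omega⟩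
      have e2 := hu (a, b, 11) ⟨hm, by simp only; omega⟩
      have e := e1.trans e2.symm
      simp only [Prod.mk.injEq] at e
      obtain ⟨rfl, rfl, rfl⟩ := e
      exact tw_big _ ha _ hb
    · exact tw_one a ha b hb x (by omega) y (by omega) h (by omega) (by omega) (by omega) hov
  have h3 := Finset.sum_le_card_nsmul T _ 1 bound
  have h4 := wt_total a ha b hb
  rw [key] at h3
  simp only [nsmul_eq_mul, mul_one] at h3
  omega

def exT : Finset (ℕ × ℕ × ℕ) :=
  {(0, 0, 11), (11, 11, 2),
   (11, 0, 2), (11, 2, 2), (11, 4, 2), (11, 6, 2), (11, 8, 2), (11, 10, 1), (12, 10, 1),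
   (0, 11, 2), (2, 11, 2), (4, 11, 2), (6, 11, 2), (8, 11, 2), (10, 11, 1), (10, 12, 1)}

set_option synthInstance.maxHeartbeats 400000 in
set_option synthInstance.maxSize 10000 in
theorem exT_cover : ∀ i < 13, ∀ j < 13, ∃ t ∈ exT,
    (t.1 ≤ i ∧ i < t.1 + t.2.2 ∧ t.2.1 ≤ j ∧ j < t.2.1 + t.2.2) ∧
    ∀ u ∈ exT, (u.1 ≤ i ∧ i < u.1 + u.2.2 ∧ u.2.1 ≤ j ∧ j < u.2.1 + u.2.2) → u = t := by
  decide +kernel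

theorem min_tiles_13_with_11 :
    (∀ T : Finset (ℕ × ℕ × ℕ), IsSquaredTiling 13 T →
      (∃ t ∈ T, t.2.2 = 11) → 16 ≤ T.card) ∧
    (∃ T : Finset (ℕ × ℕ × ℕ), IsSquaredTiling 13 T ∧
      (∃ t ∈ T, t.2.2 = 11) ∧ T.card = 16) := by
  refine ⟨lower, exT, ⟨by decide +kernel, ?_⟩, by decide +kernel, by decide +kernel⟩
  intro i j hi hj
  obtain ⟨t, ht, hc, hu⟩ := exT_cover i hi j hj
  exact ⟨t, ⟨ht, hc⟩, fun u hu' => hu u hu'.1 hu'.2⟩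
end

section
/- For every integer r ≥ 2, one has s(2^r − 1) ≤ 3r; that is, the (2^r − 1)×(2^r − 1) square can be tiled by at most 3r strictly smaller integer squares. -/
def Cov (t : ℕ × ℕ × ℕ) (i j : ℕ) : Prop :=
  t.1 ≤ i ∧ i < t.1 + t.2.2 ∧ t.2.1 ≤ j ∧ j < t.2.1 + t.2.2

/-- Adding one square to an exact cover of a region. -/
theorem add_square (T : Finset (ℕ × ℕ × ℕ)) (R R' : ℕ → ℕ → Prop) (q : ℕ × ℕ × ℕ)
    (h1 : ∀ i j, R i j → ∃! t, t ∈ T ∧ Cov t i j)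
    (h2 : ∀ i j, ∀ t ∈ T, Cov t i j → R i j)
    (hd : ∀ i j, Cov q i j → ¬ R i j)
    (hR : ∀ i j, R' i j ↔ (R i j ∨ Cov q i j)) :
    (∀ i j, R' i j → ∃! t, t ∈ insert q T ∧ Cov t i j) ∧
    (∀ i j, ∀ t ∈ insert q T, Cov t i j → R' i j) := by
  constructor
  · intro i j h
    rcases (hR i j).1 h with h | h
    · obtain ⟨t, ⟨ht, hc⟩, hu⟩ := h1 i j h
      refine ⟨t, ⟨Finset.mem_insert_of_mem ht, hc⟩, ?_⟩
      rintro u ⟨hu1, hu2⟩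
      rcases Finset.mem_insert.1 hu1 with rfl | hu1
      · exact absurd h (hd i j hu2)
      · exact hu u ⟨hu1, hu2⟩
    · refine ⟨q, ⟨Finset.mem_insert_self _ _, h⟩, ?_⟩
      rintro u ⟨hu1, hu2⟩
      rcases Finset.mem_insert.1 hu1 with rfl | hu1
      · rfl
      · exact absurd (h2 i j u hu1 hu2) (hd i j h)
  · intro i j t ht hc
    rcases Finset.mem_insert.1 ht with rfl | ht
    · exact (hR i j).2 (Or.inr hc)
    · exact (hR i j).2 (Or.inl (h2 i j t ht hc))

theorem add_three (T : Finset (ℕ × ℕ × ℕ)) (R R' : ℕ → ℕ → Prop) (q1 q2 q3 : ℕ × ℕ × ℕ)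
    (h1 : ∀ i j, R i j → ∃! t, t ∈ T ∧ Cov t i j)
    (h2 : ∀ i j, ∀ t ∈ T, Cov t i j → R i j)
    (hd1 : ∀ i j, Cov q1 i j → ¬ R i j)
    (hd2 : ∀ i j, Cov q2 i j → ¬ (R i j ∨ Cov q1 i j))
    (hd3 : ∀ i j, Cov q3 i j → ¬ ((R i j ∨ Cov q1 i j) ∨ Cov q2 i j))
    (hR : ∀ i j, R' i j ↔ (((R i j ∨ Cov q1 i j) ∨ Cov q2 i j) ∨ Cov q3 i j)) :
    (∀ i j, R' i j → ∃! t, t ∈ insert q3 (insert q2 (insert q1 T)) ∧ Cov t i j) ∧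
    (∀ i j, ∀ t ∈ insert q3 (insert q2 (insert q1 T)), Cov t i j → R' i j) := by
  have a := add_square T R _ q1 h1 h2 hd1 (fun i j => Iff.rfl)
  have b := add_square _ _ _ q2 a.1 a.2 hd2 (fun i j => Iff.rfl)
  exact add_square _ _ R' q3 b.1 b.2 hd3 hR

theorem card_three (T : Finset (ℕ × ℕ × ℕ)) (q1 q2 q3 : ℕ × ℕ × ℕ) :
    (insert q3 (insert q2 (insert q1 T))).card ≤ T.card + 3 := by
  have := Finset.card_insert_le q1 T
  have := Finset.card_insert_le q2 (insert q1 T)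
  have := Finset.card_insert_le q3 (insert q2 (insert q1 T))
  omega

def Reg (a m i j : ℕ) : Prop :=
  a ≤ i ∧ i < a + m ∧ a ≤ j ∧ j < a + m ∧ ¬ (i = a ∧ j = a)

theorem corner (a k : ℕ) : ∃ T : Finset (ℕ × ℕ × ℕ), T.card ≤ 3 * k ∧
    (∀ t ∈ T, 1 ≤ t.2.2 ∧ t.2.2 ≤ 2 ^ k ∧ t.1 + t.2.2 ≤ a + 2 ^ k ∧ t.2.1 + t.2.2 ≤ a + 2 ^ k) ∧
    (∀ i j, Reg a (2 ^ k) i j → ∃! t, t ∈ T ∧ Cov t i j) ∧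
    (∀ i j, ∀ t ∈ T, Cov t i j → Reg a (2 ^ k) i j) := by
  induction k with
  | zero =>
    refine ⟨∅, by simp, by simp, ?_, by simp⟩
    intro i j h
    unfold Reg at h
    omega
  | succ k ih =>
    obtain ⟨T, hc, hb, h1, h2⟩ := ih
    have hm : 0 < 2 ^ k := by positivity
    rw [pow_succ]
    generalize 2 ^ k = m at *
    refine ⟨insert (a + m, a + m, m) (insert (a, a + m, m) (insert (a + m, a, m) T)), ?_, ?_, ?_⟩
    · have := card_three T (a + m, a, m) (a, a + m, m) (a + m, a + m, m)
      omega
    · intro t ht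
      simp only [Finset.mem_insert] at ht
      rcases ht with rfl | rfl | rfl | ht
      · dsimp only; omega
      · dsimp only; omega
      · dsimp only; omega
      · have := hb t ht
        omega
    · apply add_three T _ _ _ _ _ h1 h2 <;> intro i j <;> simp only [Reg, Cov] <;> omega

theorem s_two_pow_sub_one_le (r : ℕ) (hr : 2 ≤ r) : s (2 ^ r - 1) ≤ 3 * r := by
  obtain ⟨k, rfl⟩ : ∃ k, r = k + 2 := ⟨r - 2, by omega⟩
  obtain ⟨T, hc, hb, h1, h2⟩ := corner (2 ^ (k + 1) - 1) (k + 1)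
  have hm : 2 ≤ 2 ^ (k + 1) := by
    have : 0 < 2 ^ k := by positivity
    rw [pow_succ]; omega
  rw [show k + 2 = (k + 1) + 1 from rfl, pow_succ]
  generalize 2 ^ (k + 1) = m at *
  have key := add_three T _ (fun i j => i < m * 2 - 1 ∧ j < m * 2 - 1)
    (0, 0, m) (m, 0, m - 1) (0, m, m - 1) h1 h2
    (by intro i j; simp only [Reg, Cov]; omega)
    (by intro i j; simp only [Reg, Cov]; omega)
    (by intro i j; simp only [Reg, Cov]; omega)
    (by intro i j; simp only [Reg, Cov]; omega)
  have hcard := card_three T (0, 0, m) (m, 0, m - 1) (0, m, m - 1)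
  refine le_trans (Nat.sInf_le ⟨_, ⟨?_, fun i j hi hj => key.1 i j ⟨hi, hj⟩⟩, rfl⟩) (by omega)
  intro t ht
  simp only [Finset.mem_insert] at ht
  rcases ht with rfl | rfl | rfl | ht
  · dsimp only; omega
  · dsimp only; omega
  · dsimp only; omega
  · have := hb t ht
    omega
end

section
/- (Conway's lower bound) For every prime number p, one has s(p) ≥ log₂(p), where log₂ denotes the real base-2 logarithm. -/
open Matrix Finset

/-- incidence-like matrices have determinant in {-1,0,1}. -/
theorem tu_aux : ∀ (n : ℕ) (g a c : Fin n → ℕ), Function.Injective g →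
    |(Matrix.of fun r j : Fin n => (if g j = a r then (1:ℤ) else 0) -
      (if g j = c r then 1 else 0)).det| ≤ 1 := by
  intro n
  induction n with
  | zero => intro g a c _; simp
  | succ n ih =>
    intro g a c hg
    set M : Matrix (Fin (n+1)) (Fin (n+1)) ℤ := Matrix.of fun r j : Fin (n+1) =>
      (if g j = a r then (1:ℤ) else 0) - (if g j = c r then 1 else 0) with hM
    have key : ∀ r j0, (∀ j, j ≠ j0 → M r j = 0) → |M r j0| ≤ 1 → |M.det| ≤ 1 := by
      intro r j0 h0 h1
      rw [Matrix.det_succ_row M r, Finset.sum_eq_single j0]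
      · rw [abs_mul, abs_mul, abs_pow, abs_neg, abs_one, one_pow, one_mul]
        have := ih (g ∘ j0.succAbove) (a ∘ r.succAbove) (c ∘ r.succAbove)
          (hg.comp Fin.succAbove_right_injective)
        have h2 : |(M.submatrix r.succAbove j0.succAbove).det| ≤ 1 := this
        calc _ ≤ (1:ℤ) * 1 := mul_le_mul h1 h2 (abs_nonneg _) (by norm_num)
          _ = 1 := by norm_num
      · intro j _ hj
        rw [h0 j hj]; ring
      · simp
    by_cases hA : ∀ r, (∃ j, g j = a r) ∧ (∃ j, g j = c r)
    · have : M.det = 0 := by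
        apply Matrix.exists_mulVec_eq_zero_iff.mp
        refine ⟨fun _ => 1, fun h => by simpa using congrFun h 0, ?_⟩
        ext r
        obtain ⟨⟨j1, h1⟩, ⟨j2, h2⟩⟩ := hA r
        simp [Matrix.mulVec, dotProduct, hM, ← h1, ← h2, hg.eq_iff]
      rw [this]; simp
    · push Not at hA
      obtain ⟨r, hr⟩ := hA
      by_cases h1 : ∃ j, g j = a r
      · have h2 := hr h1
        obtain ⟨j1, h1⟩ := h1
        refine key r j1 (fun j hj => ?_) ?_
        · simp [hM, h2 j, ← h1, hg.eq_iff, hj]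
        · have h2 := h2 j1
          rw [h1] at h2
          simp [hM, h1, h2]
      · push Not at h1
        by_cases h2 : ∃ j, g j = c r
        · obtain ⟨j2, h2⟩ := h2
          refine key r j2 (fun j hj => ?_) ?_
          · simp [hM, h1 j, ← h2, hg.eq_iff, hj]
          · have h1 := h1 j2
            rw [h2] at h1
            simp [hM, h1, h2]
        · push Not at h2
          refine key r 0 (fun j hj => ?_) ?_
          · simp [hM, h1 j, h2 j]
          · simp [hM, h1 0, h2 0]

theorem tu_gen {N : Type*} [Fintype N] [DecidableEq N] (g a c : N → ℕ)
    (hg : Function.Injective g) :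
    |(Matrix.of fun r j : N => (if g j = a r then (1:ℤ) else 0) -
      (if g j = c r then 1 else 0)).det| ≤ 1 := by
  let e := (Fintype.equivFin N).symm
  rw [← Matrix.det_submatrix_equiv_self e]
  exact tu_aux _ (g ∘ e) (a ∘ e) (c ∘ e) (hg.comp e.injective)

theorem det_gram {N K : Type*} [Fintype N] [DecidableEq N] [Fintype K]
    (B : Matrix K N ℤ) :
    (Bᵀ * B).det = ∑ f : N → K, (∏ i, B (f i) i) * (B.submatrix f id).det := by
  have h : (Bᵀ * B) = fun i => ∑ k, B k i • B k := by
    ext i j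
    simp [Matrix.mul_apply, Finset.sum_apply]
  have h2 := (Matrix.detRowAlternating (R := ℤ) (n := N)).toMultilinearMap.map_sum
    (fun (i : N) (k : K) => B k i • B k)
  have h3 : (Bᵀ * B).det = _ := (congrArg Matrix.det h).trans h2
  rw [h3]
  refine Finset.sum_congr rfl fun f _ => ?_
  rw [MultilinearMap.map_smul_univ]
  rfl

theorem gram_sum {N K : Type*} [Fintype N] [DecidableEq N] [Fintype K]
    (B : Matrix K N ℤ) :
    ((Fintype.card N).factorial : ℤ) * (Bᵀ * B).det =
      ∑ f : N → K, (B.submatrix f id).det ^ 2 := by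
  have h1 : ∀ σ : Equiv.Perm N, (Bᵀ * B).det =
      ∑ f : N → K, ((Equiv.Perm.sign σ : ℤ) * ∏ i, B (f (σ i)) i) * (B.submatrix f id).det := by
    intro σ
    rw [det_gram]
    symm
    refine Fintype.sum_equiv (Equiv.arrowCongr σ.symm (Equiv.refl K)) _ _ fun f => ?_
    have := Matrix.det_permute σ (B.submatrix f id)
    have h4 : (B.submatrix (Equiv.arrowCongr σ.symm (Equiv.refl K) f) id) =
      (B.submatrix f id).submatrix σ id := by
      ext i j; simp
    rw [h4, this]
    simp
    ring
  have h2 : ∑ σ : Equiv.Perm N, (Bᵀ * B).det = ((Fintype.card N).factorial : ℤ) * (Bᵀ * B).det := by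
    simp [Fintype.card_perm]
  rw [← h2, Finset.sum_congr rfl (fun σ _ => h1 σ), Finset.sum_comm]
  refine Finset.sum_congr rfl fun f _ => ?_
  rw [← Finset.sum_mul, sq, Matrix.det_apply' (B.submatrix f id)]
  simp

theorem gram_le {N K : Type*} [Fintype N] [DecidableEq N] [Fintype K] [DecidableEq K]
    (B : Matrix K N ℤ) (hB : ∀ f : N → K, |(B.submatrix f id).det| ≤ 1) :
    (Bᵀ * B).det ≤ 2 ^ (Fintype.card K) := by
  have h1 : ∑ f : N → K, (B.submatrix f id).det ^ 2 ≤
      ∑ f : N → K, if Function.Injective f then (1:ℤ) else 0 := by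
    refine Finset.sum_le_sum fun f _ => ?_
    split_ifs with hf
    · exact (sq_le_one_iff_abs_le_one _).mpr (hB f)
    · simp only [Function.Injective] at hf
      push Not at hf
      obtain ⟨i, j, hij, hne⟩ := hf
      rw [Matrix.det_zero_of_row_eq hne (by ext k; simp [hij])]
      simp
  have h2 : (∑ f : N → K, if Function.Injective f then (1:ℤ) else 0) =
      (Fintype.card N).factorial * ((Fintype.card K).choose (Fintype.card N)) := by
    rw [Finset.sum_boole]
    rw [← Fintype.card_subtype]
    rw [Fintype.card_congr (Equiv.subtypeInjectiveEquivEmbedding N K), Fintype.card_embedding_eq,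
      Nat.descFactorial_eq_factorial_mul_choose]
    push_cast; rfl
  rw [← gram_sum, h2] at h1
  have h3 := le_of_mul_le_mul_left h1 (by exact_mod_cast Nat.factorial_pos _)
  refine h3.trans ?_
  exact_mod_cast Nat.choose_le_two_pow _ _

theorem row_sum {p : ℕ} {T : Finset (ℕ × ℕ × ℕ)} (hT : IsSquaredTiling p T) (j : ℕ) (hj : j < p) :
    ∑ t ∈ T, (if t.2.1 ≤ j ∧ j < t.2.1 + t.2.2 then (t.2.2 : ℤ) else 0) = p := by
  have h1 : ∀ i ∈ range p, (1:ℤ) = ∑ t ∈ T, if (t.2.1 ≤ j ∧ j < t.2.1 + t.2.2) ∧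
      (t.1 ≤ i ∧ i < t.1 + t.2.2) then 1 else 0 := by
    intro i hi
    obtain ⟨t, ⟨ht, h1, h2, h3, h4⟩, hu⟩ := hT.2 i j (mem_range.mp hi) hj
    rw [Finset.sum_eq_single t]
    · simp [h1, h2, h3, h4]
    · intro t' ht' hne
      rw [if_neg]
      rintro ⟨⟨a, b⟩, c, d⟩
      exact hne (hu t' ⟨ht', c, d, a, b⟩)
    · intro h; exact absurd ht h
  have h2 : (p:ℤ) = ∑ i ∈ range p, (1:ℤ) := by simp
  rw [h2, Finset.sum_congr rfl h1, Finset.sum_comm]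
  refine Finset.sum_congr rfl fun t ht => ?_
  by_cases h : t.2.1 ≤ j ∧ j < t.2.1 + t.2.2
  · simp only [h, true_and, and_self, if_true]
    rw [Finset.sum_boole]
    have : {i ∈ range p | t.1 ≤ i ∧ i < t.1 + t.2.2} = Finset.Ico t.1 (t.1 + t.2.2) := by
      ext i
      have := (hT.1 t ht).2.2.1
      simp
      omega
    rw [this]; simp
  · rw [if_neg h]
    simp [h]

theorem flow {p : ℕ} {T : Finset (ℕ × ℕ × ℕ)} (hT : IsSquaredTiling p T) (w : ℕ) (h0 : 0 < w)
    (hw : w ≤ p) :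
    ∑ t ∈ T, ((if w = t.2.1 + t.2.2 then (1:ℤ) else 0) - (if w = t.2.1 then 1 else 0)) * t.2.2
      = if w = p then (p:ℤ) else 0 := by
  have h1 := row_sum hT (w - 1) (by omega)
  split_ifs with h
  · rw [← h1]
    refine Finset.sum_congr rfl fun t ht => ?_
    have := hT.1 t ht
    split_ifs <;> first | omega | simp
  · have h2 := row_sum hT w (by omega)
    have h3 := congrArg₂ (· - ·) h1 h2
    simp only [← Finset.sum_sub_distrib, sub_self] at h3
    refine Eq.trans ?_ h3
    refine Finset.sum_congr rfl fun t ht => ?_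
    have := hT.1 t ht
    split_ifs <;> first | omega | simp

theorem tiling_bound {p : ℕ} (hp : p.Prime) {T : Finset (ℕ × ℕ × ℕ)} (hT : IsSquaredTiling p T) :
    p ≤ 2 ^ T.card := by
  classical
  set W : Finset ℕ := T.image (fun t => t.2.1 + t.2.2) with hW
  have hWpos : ∀ w ∈ W, 0 < w ∧ w ≤ p := by
    intro w hw
    obtain ⟨t, ht, rfl⟩ := Finset.mem_image.mp hw
    have := hT.1 t ht
    omega
  -- starting heights are zero or in W
  have hstart : ∀ t ∈ T, t.2.1 = 0 ∨ t.2.1 ∈ W := by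
    intro t ht
    by_contra hcon
    push Not at hcon
    obtain ⟨hc0, hc1⟩ := hcon
    have hb := hT.1 t ht
    have hf := flow hT t.2.1 (by omega) (by omega)
    rw [if_neg (by omega)] at hf
    have hle : ∀ u ∈ T, ((if t.2.1 = u.2.1 + u.2.2 then (1:ℤ) else 0) -
        (if t.2.1 = u.2.1 then 1 else 0)) * u.2.2 ≤ 0 := by
      intro u hu
      have : t.2.1 ≠ u.2.1 + u.2.2 := by
        intro h
        exact hc1 (Finset.mem_image.mpr ⟨u, hu, h.symm⟩)
      rw [if_neg this]
      split_ifs <;> simp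
    have := (Finset.sum_eq_zero_iff_of_nonpos hle).mp hf t ht
    rw [if_neg (by omega), if_pos rfl] at this
    simp at this
    omega
  let B : Matrix T W ℤ := Matrix.of fun t j =>
    (if (j : ℕ) = t.1.2.1 + t.1.2.2 then (1:ℤ) else 0) - (if (j:ℕ) = t.1.2.1 then 1 else 0)
  -- action of B
  have hBv : ∀ (x : ℕ → ℤ), x 0 = 0 → ∀ t : T,
      (B *ᵥ fun j => x j) t = x (t.1.2.1 + t.1.2.2) - x t.1.2.1 := by
    intro x hx t
    have e : (B *ᵥ fun j => x j) t = ∑ j ∈ W, ((if j = t.1.2.1 + t.1.2.2 then (1:ℤ) else 0) -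
        (if j = t.1.2.1 then 1 else 0)) * x j := by
      rw [← Finset.sum_coe_sort]
      rfl
    rw [e]
    simp only [sub_mul, Finset.sum_sub_distrib, ite_mul, one_mul, zero_mul, Finset.sum_ite_eq']
    have m1 : t.1.2.1 + t.1.2.2 ∈ W := Finset.mem_image.mpr ⟨t.1, t.2, rfl⟩
    rw [if_pos m1]
    rcases hstart t.1 t.2 with h | h
    · rw [h, hx]; simp
    · rw [if_pos h]
  have hle : (Bᵀ * B).det ≤ 2 ^ T.card := by
    have := gram_le B (fun f => tu_gen (fun j : W => (j:ℕ)) (fun r => (f r).1.2.1 + (f r).1.2.2)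
      (fun r => (f r).1.2.1) Subtype.val_injective)
    simpa using this
  have hnn : 0 ≤ (Bᵀ * B).det := by
    have h := gram_sum B
    have h2 : 0 ≤ ∑ f : W → T, (B.submatrix f id).det ^ 2 :=
      Finset.sum_nonneg fun f _ => sq_nonneg _
    rw [← h] at h2
    exact nonneg_of_mul_nonneg_right h2 (by exact_mod_cast Nat.factorial_pos _)
  have hne : (Bᵀ * B).det ≠ 0 := by
    intro h0
    obtain ⟨v, hv, hv0⟩ := Matrix.exists_mulVec_eq_zero_iff.mpr h0
    apply hv
    have h1 : B *ᵥ v = 0 := by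
      have : (B *ᵥ v) ⬝ᵥ (B *ᵥ v) = 0 := by
        rw [Matrix.dotProduct_mulVec, Matrix.vecMul_mulVec]
        rw [← Matrix.dotProduct_mulVec, hv0]
        simp
      exact dotProduct_self_eq_zero.mp this
    let x : ℕ → ℤ := fun j => if h : j ∈ W then v ⟨j, h⟩ else 0
    have hx0 : x 0 = 0 := dif_neg (fun h => absurd (hWpos 0 h).1 (by simp))
    have hxv : (fun j : W => x j) = v := by
      ext j; simp [x]
    have h2 : ∀ t ∈ T, x (t.2.1 + t.2.2) = x t.2.1 := by
      intro t ht
      have := hBv x hx0 ⟨t, ht⟩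
      rw [hxv, h1] at this
      simp only [Pi.zero_apply] at this
      linarith
    have h3 : ∀ n, x n = 0 := by
      intro n
      induction n using Nat.strong_induction_on with
      | _ n ih =>
        by_cases hn : n ∈ W
        · obtain ⟨t, ht, rfl⟩ := Finset.mem_image.mp hn
          have hb := hT.1 t ht
          rw [h2 t ht]
          exact ih _ (by omega)
        · exact dif_neg hn
    rw [← hxv]
    ext j
    exact h3 _
  have hdvd : (p : ℤ) ∣ (Bᵀ * B).det := by
    let φ : W → ℤ := fun j => ((j : ℕ) : ℤ)
    have hL : ∀ w : W, ((Bᵀ * B) *ᵥ φ) w = if (w : ℕ) = p then (p:ℤ) else 0 := by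
      intro w
      rw [← Matrix.mulVec_mulVec]
      have e : B *ᵥ φ = fun t : T => (t.1.2.2 : ℤ) := by
        ext t
        rw [hBv (fun n => (n:ℤ)) (by simp) t]
        push_cast; ring
      rw [e, ← flow hT w (hWpos w w.2).1 (hWpos w w.2).2, ← Finset.sum_coe_sort T]
      rfl
    have hadj : (Bᵀ * B).adjugate *ᵥ ((Bᵀ * B) *ᵥ φ) = (Bᵀ * B).det • φ := by
      rw [Matrix.mulVec_mulVec, Matrix.adjugate_mul, Matrix.smul_mulVec, Matrix.one_mulVec]
    obtain ⟨t, ⟨ht, -, -, h3, -⟩, -⟩ := hT.2 0 0 hp.pos hp.pos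
    have hb := hT.1 t ht
    have m1 : t.2.1 + t.2.2 ∈ W := Finset.mem_image.mpr ⟨t, ht, rfl⟩
    have h4 := congrFun hadj ⟨_, m1⟩
    have h5 : (p:ℤ) ∣ (Bᵀ * B).det * ((t.2.1 + t.2.2 : ℕ) : ℤ) := by
      have : (Bᵀ * B).det * ((t.2.1 + t.2.2 : ℕ) : ℤ) = ((Bᵀ * B).det • φ) ⟨_, m1⟩ := by
        simp [φ]
      rw [this, ← h4]
      refine Finset.dvd_sum fun w _ => ?_
      rw [hL w]
      split_ifs <;> simp
    rcases (Nat.prime_iff_prime_int.mp hp).dvd_or_dvd h5 with h | h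
    · exact h
    · exfalso
      have := Nat.le_of_dvd (by omega) (Int.natCast_dvd_natCast.mp h)
      omega
  have := Int.le_of_dvd (lt_of_le_of_ne hnn hne.symm) hdvd
  exact_mod_cast this.trans hle

theorem tiling_exists {p : ℕ} (hp : 2 ≤ p) : ∃ T, IsSquaredTiling p T := by
  refine ⟨(range p ×ˢ range p).image (fun q => (q.1, q.2, 1)), ?_, ?_⟩
  · intro t ht
    obtain ⟨q, hq, rfl⟩ := Finset.mem_image.mp ht
    simp at hq
    dsimp only
    omega
  · intro i j hi hj
    refine ⟨(i, j, 1), ⟨?_, by simp⟩, ?_⟩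
    · exact Finset.mem_image.mpr ⟨(i, j), by simp [hi, hj], rfl⟩
    · rintro t ⟨ht, h⟩
      obtain ⟨q, hq, rfl⟩ := Finset.mem_image.mp ht
      dsimp only at h
      ext <;> dsimp only <;> omega

theorem conway_lower_bound (p : ℕ) (hp : p.Prime) :
    Real.logb 2 (p : ℝ) ≤ (s p : ℝ) := by
  obtain ⟨T0, hT0⟩ := tiling_exists hp.two_le
  have hmem : s p ∈ {k | ∃ T : Finset (ℕ × ℕ × ℕ), IsSquaredTiling p T ∧ T.card = k} :=
    Nat.sInf_mem ⟨_, T0, hT0, rfl⟩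
  obtain ⟨T, hT, hk⟩ := hmem
  have := tiling_bound hp hT
  rw [hk] at this
  rw [Real.logb_le_iff_le_rpow (by norm_num) (by exact_mod_cast hp.pos), Real.rpow_natCast]
  exact_mod_cast this
end

section
/- s(7) = 9: the minimum number of squares in a squared tiling of the 7×7 square by strictly smaller integer squares equals 9. -/
def sq7Cov (i j : ℕ) (t : ℕ × ℕ × ℕ) : Bool :=
  Nat.ble t.1 i && Nat.blt i (t.1 + t.2.2) && Nat.ble t.2.1 j && Nat.blt j (t.2.1 + t.2.2)

def sq7Dis (i j h : ℕ) (t : ℕ × ℕ × ℕ) : Bool :=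
  Nat.ble (t.1 + t.2.2) i || Nat.ble (t.2.1 + t.2.2) j || Nat.ble (j + h) t.2.1
    || Nat.ble (i + h) t.1

/-- Backtracking search: can the partial tiling `L`, covering all cells before number `49 - f`
in row-major order, be extended to a tiling with at most 8 squares? -/
def sq7Search : ℕ → List (ℕ × ℕ × ℕ) → Bool
  | 0, _ => true
  | f + 1, L =>
    cond (L.any (sq7Cov ((48 - f) / 7) ((48 - f) % 7))) (sq7Search f L)
      (cond (Nat.ble 8 L.length) false
        ([1, 2, 3, 4, 5, 6].any fun h =>
          Nat.ble ((48 - f) / 7 + h) 7 && (Nat.ble ((48 - f) % 7 + h) 7 &&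
            (L.all (sq7Dis ((48 - f) / 7) ((48 - f) % 7) h) &&
              sq7Search f (((48 - f) / 7, (48 - f) % 7, h) :: L)))))

lemma sq7Cov_iff (i j : ℕ) (t : ℕ × ℕ × ℕ) : sq7Cov i j t = true ↔
    (t.1 ≤ i ∧ i < t.1 + t.2.2 ∧ t.2.1 ≤ j ∧ j < t.2.1 + t.2.2) := by
  simp [sq7Cov, Nat.blt, and_assoc, Nat.succ_le_iff]

lemma sq7Search_false : sq7Search 49 [] = false := by decide +kernel

lemma sq7Search_true (T : Finset (ℕ × ℕ × ℕ)) (hT : IsSquaredTiling 7 T) (hc : T.card ≤ 8) :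
    ∀ (f : ℕ) (L : List (ℕ × ℕ × ℕ)), f ≤ 49 → (∀ t ∈ L, t ∈ T) → L.Nodup →
      (∀ i j, i < 7 → j < 7 → 7 * i + j < 49 - f → ∃ t ∈ L, sq7Cov i j t = true) →
      sq7Search f L = true := by
  obtain ⟨h1, h2⟩ := hT
  intro f
  induction f with
  | zero => intros; rfl
  | succ f ih =>
    intro L hf hL hnd hcov
    obtain ⟨i, hi⟩ : ∃ i, i = (48 - f) / 7 := ⟨_, rfl⟩
    obtain ⟨j, hj⟩ : ∃ j, j = (48 - f) % 7 := ⟨_, rfl⟩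
    have hi7 : i < 7 := by omega
    have hj7 : j < 7 := by omega
    have hij : 7 * i + j = 48 - f := by omega
    unfold sq7Search
    rw [← hi, ← hj]
    by_cases hb : L.any (sq7Cov i j) = true
    · rw [hb, cond_true]
      refine ih L (by omega) hL hnd ?_
      intro a b ha hb7 hab
      by_cases hlt : 7 * a + b < 49 - (f + 1)
      · exact hcov a b ha hb7 hlt
      · have e1 : a = i := by omega
        have e2 : b = j := by omega
        subst e1 e2
        simpa using hb
    · have hb' : ∀ t ∈ L, ¬ sq7Cov i j t = true := by
        intro t ht h
        exact hb (List.any_eq_true.2 ⟨t, ht, h⟩)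
      rw [Bool.not_eq_true] at hb
      rw [hb, cond_false]
      obtain ⟨⟨x, y, h⟩, ⟨htT, c1, c2, c3, c4⟩, -⟩ := h2 i j hi7 hj7
      obtain ⟨g1, g2, g3, g4⟩ := h1 _ htT
      simp only at c1 c2 c3 c4 g1 g2 g3 g4
      have htL : (x, y, h) ∉ L := fun hm =>
        hb' _ hm ((sq7Cov_iff _ _ _).2 ⟨c1, c2, c3, c4⟩)
      have hxy : ¬ 7 * x + y < 49 - (f + 1) := by
        intro hlt
        obtain ⟨t, htm, htc⟩ := hcov x y (by omega) (by omega) hlt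
        have := (h2 x y (by omega) (by omega)).unique ⟨hL t htm, (sq7Cov_iff _ _ _).1 htc⟩
          ⟨htT, le_refl _, by simp only; omega, le_refl _, by simp only; omega⟩
        exact htL (this ▸ htm)
      have e1 : x = i := by omega
      have e2 : y = j := by omega
      subst e1 e2
      have hnd' : ((x, y, h) :: L).Nodup := List.nodup_cons.2 ⟨htL, hnd⟩
      have hL' : ∀ t ∈ (x, y, h) :: L, t ∈ T := by
        intro t ht
        rcases List.mem_cons.1 ht with rfl | ht
        · exact htT
        · exact hL t ht
      have hlen : L.length + 1 ≤ 8 := by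
        have e := List.toFinset_card_of_nodup hnd'
        have : ((x, y, h) :: L).toFinset.card ≤ T.card :=
          Finset.card_le_card fun t ht => hL' t (List.mem_toFinset.1 ht)
        rw [List.length_cons] at e
        omega
      have hble : Nat.ble 8 L.length = false := by
        rw [← Bool.not_eq_true, Nat.ble_eq]; omega
      rw [hble, cond_false, List.any_eq_true]
      refine ⟨h, ?_, ?_⟩
      · have : h ≤ 6 := by omega
        interval_cases h <;> simp
      · rw [Bool.and_eq_true, Bool.and_eq_true, Bool.and_eq_true, Nat.ble_eq, Nat.ble_eq,
          List.all_eq_true]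
        refine ⟨g3, g4, ?_, ?_⟩
        · rintro ⟨a, b, k⟩ ht
          by_contra hd
          simp only [sq7Dis, Bool.or_eq_true, Nat.ble_eq] at hd
          have g := h1 _ (hL _ ht)
          simp only at g
          have := (h2 (max a x) (max b y) (by omega) (by omega)).unique
            (y₁ := (a, b, k)) (y₂ := (x, y, h))
            ⟨hL _ ht, by simp only; omega⟩ ⟨htT, by simp only; omega⟩
          exact htL (this ▸ ht)
        · refine ih _ (by omega) hL' hnd' ?_
          intro a b ha hb7 hab
          by_cases hlt : 7 * a + b < 49 - (f + 1)
          · obtain ⟨t, h3, h4⟩ := hcov a b ha hb7 hlt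
            exact ⟨t, List.mem_cons_of_mem _ h3, h4⟩
          · have e1 : a = x := by omega
            have e2 : b = y := by omega
            subst e1 e2
            exact ⟨_, List.mem_cons_self, (sq7Cov_iff _ _ _).2 ⟨c1, c2, c3, c4⟩⟩

def sq7Tiling : Finset (ℕ × ℕ × ℕ) :=
  {(0, 0, 4), (0, 4, 3), (3, 4, 2), (3, 6, 1), (4, 0, 3), (4, 3, 1), (4, 6, 1), (5, 3, 2), (5, 5, 2)}

lemma sq7Tiling_ok : IsSquaredTiling 7 sq7Tiling := by
  refine ⟨by decide +kernel, ?_⟩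
  have key : ∀ i < 7, ∀ j < 7, ∃ t ∈ sq7Tiling, sq7Cov i j t = true ∧
      ∀ u ∈ sq7Tiling, sq7Cov i j u = true → u = t := by decide +kernel
  intro i j hi hj
  obtain ⟨t, ht, hc, hu⟩ := key i hi j hj
  exact ⟨t, ⟨ht, (sq7Cov_iff _ _ _).1 hc⟩, fun u ⟨hu1, hu2⟩ => hu u hu1 ((sq7Cov_iff _ _ _).2 hu2)⟩

theorem s_7 : s 7 = 9 := by
  have hmem : 9 ∈ {k | ∃ T : Finset (ℕ × ℕ × ℕ), IsSquaredTiling 7 T ∧ T.card = k} :=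
    ⟨sq7Tiling, sq7Tiling_ok, by decide +kernel⟩
  refine le_antisymm (Nat.sInf_le hmem) ?_
  refine le_csInf ⟨9, hmem⟩ ?_
  rintro k ⟨T, hT, rfl⟩
  by_contra hlt
  have := sq7Search_true T hT (by omega) 49 [] le_rfl (by simp) List.nodup_nil
    (by intro i j _ _ h; omega)
  rw [sq7Search_false] at this
  exact Bool.noConfusion this
end

section
/- s(11) = 11: the minimum number of squares in a squared tiling of the 11×11 square by strictly smaller integer squares equals 11. -/
namespace SqT

/-- bit mask of the set of entries -/
noncomputable def bits (c : List ℕ) : ℕ :=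
  List.rec (motive := fun _ => ℕ) 0 (fun a _ ih => Nat.lor (Nat.shiftLeft 1 a) ih) c

noncomputable def bit (m v : ℕ) : ℕ := Nat.land (Nat.shiftRight m v) 1

noncomputable def pop (m n : ℕ) : ℕ :=
  Nat.rec (motive := fun _ => ℕ) 0 (fun v ih => Nat.add (bit m v) ih) n

noncomputable def low (m n : ℕ) : ℕ → ℕ :=
  Nat.rec (motive := fun _ => ℕ → ℕ) (fun v => v)
    (fun _ ih v => bif Nat.beq (bit m v) 1 then v else ih (Nat.succ v)) n

noncomputable def run (v : ℕ) (c : List ℕ) : ℕ :=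
  List.rec (motive := fun _ => ℕ) 0 (fun a _ ih => bif Nat.beq a v then Nat.succ ih else 0) c

noncomputable def frun (v : ℕ) (c : List ℕ) : ℕ :=
  List.rec (motive := fun _ => ℕ) 0
    (fun a l ih => bif Nat.beq a v then run v (a :: l) else ih) c

noncomputable def setn (h : ℕ) (s : ℕ) : List ℕ → List ℕ :=
  Nat.rec (motive := fun _ => List ℕ → List ℕ) (fun l => l) (fun _ ih l => h :: ih l.tail) s

noncomputable def place (v s : ℕ) (c : List ℕ) : List ℕ :=
  List.rec (motive := fun _ => List ℕ) []
    (fun a l ih => bif Nat.beq a v then setn (Nat.add v s) s (a :: l) else a :: ih) c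

/-- evaluate the number before passing it on -/
noncomputable def fN (x : ℕ) (f : ℕ → Bool) : Bool :=
  Nat.rec (motive := fun _ => Bool) (f 0) (fun n _ => f (Nat.succ n)) x

/-- evaluate the list before passing it on -/
noncomputable def fL (l : List ℕ) : (List ℕ → Bool) → Bool :=
  List.rec (motive := fun _ => (List ℕ → Bool) → Bool) (fun f => f [])
    (fun a _ ih f => Nat.rec (motive := fun _ => Bool) (ih (fun l' => f (0 :: l')))
      (fun n _ => ih (fun l' => f (Nat.succ n :: l'))) a) l

theorem fN_eq (x : ℕ) (f : ℕ → Bool) : fN x f = f x := by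
  cases x <;> rfl

theorem fL_eq (l : List ℕ) (f : List ℕ → Bool) : fL l f = f l := by
  induction l generalizing f with
  | nil => rfl
  | cons a l ih =>
    cases a with
    | zero => exact ih (fun l' => f (0 :: l'))
    | succ n => exact ih (fun l' => f (Nat.succ n :: l'))

noncomputable def loop (f : List ℕ → Bool) (v : ℕ) (c : List ℕ) (n : ℕ) : Bool :=
  Nat.rec (motive := fun _ => Bool) true (fun s ih => fL (place v (Nat.succ s) c) f && ih) n

noncomputable def mn (a b : ℕ) : ℕ := bif Nat.ble a b then a else b

noncomputable def node (f : List ℕ → Bool) (c : List ℕ) (v : ℕ) : Bool :=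
  Nat.ble (Nat.succ v) 11 && loop f v c (mn 10 (mn (frun v c) (Nat.sub 11 v)))

noncomputable def search (k : ℕ) : List ℕ → Bool :=
  Nat.rec (motive := fun _ => List ℕ → Bool) (fun c => Nat.ble 1 (pop (bits c) 11))
   (fun k ih c => fN (bits c) (fun m => Nat.ble (Nat.succ (Nat.succ k)) (pop m 11) ||
      fN (low m 11 0) (node ih c))) k

theorem search_ok : search 10 [0,0,0,0,0,0,0,0,0,0,0] = true := by
  decide +kernel

theorem bit_bits (c : List ℕ) (v : ℕ) : bit (bits c) v = if v ∈ c then 1 else 0 := by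
  have key : ∀ m, bit m v = if m.testBit v then 1 else 0 := by
    intro m
    have : bit m v = (m >>> v) % 2 := Nat.and_one_is_mod _
    rw [this, Nat.testBit_eq_decide_div_mod_eq, Nat.shiftRight_eq_div_pow]
    rcases Nat.mod_two_eq_zero_or_one (m / 2 ^ v) with h | h <;> simp [h]
  rw [key]
  have : (bits c).testBit v = decide (v ∈ c) := by
    induction c with
    | nil => simp [bits]
    | cons a l ih =>
      have e : bits (a :: l) = (1 <<< a) ||| bits l := rfl
      rw [e, Nat.testBit_or, ih, Nat.one_shiftLeft, Nat.testBit_two_pow]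
      by_cases h : a = v <;> by_cases h2 : v ∈ l <;> simp [h, h2]
      omega
  rw [this]; simp

theorem pop_bits (c : List ℕ) (n : ℕ) :
    pop (bits c) n = ((Finset.range n).filter (· ∈ c)).card := by
  induction n with
  | zero => simp [pop]
  | succ n ih =>
    have e : pop (bits c) (n+1) = bit (bits c) n + pop (bits c) n := rfl
    rw [e, ih, bit_bits, Finset.range_add_one, Finset.filter_insert]
    split_ifs
    · rw [Finset.card_insert_of_notMem (by simp)]; omega
    · omega

theorem low_spec (c : List ℕ) (n v : ℕ) :
    (∀ u, v ≤ u → u < low (bits c) n v → u ∉ c) ∧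
      (low (bits c) n v = v + n ∨ low (bits c) n v ∈ c) := by
  induction n generalizing v with
  | zero => exact ⟨fun u h1 h2 => absurd h2 (by simpa [low] using h1), Or.inl rfl⟩
  | succ n ih =>
    have e : low (bits c) (n+1) v = bif Nat.beq (bit (bits c) v) 1 then v
      else low (bits c) n (v+1) := rfl
    rw [bit_bits] at e
    by_cases hv : v ∈ c
    · simp [hv] at e
      rw [e]
      exact ⟨fun u h1 h2 => absurd h2 (by omega), Or.inr hv⟩
    · rw [if_neg hv] at e
      replace e : low (bits c) (n+1) v = low (bits c) n (v+1) := e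
      rw [e]
      obtain ⟨h1, h2⟩ := ih (v+1)
      refine ⟨fun u h3 h4 => ?_, ?_⟩
      · rcases Nat.eq_or_lt_of_le h3 with h | h
        · exact h ▸ hv
        · exact h1 u h h4
      · rcases h2 with h | h
        · left; omega
        · right; exact h

theorem run_spec (v : ℕ) (c : List ℕ) (s : ℕ) (hs : s ≤ c.length)
    (h : ∀ j, j < s → c.getD j 0 = v) : s ≤ run v c := by
  induction c generalizing s with
  | nil => simp at hs; omega
  | cons a l ih =>
    have e : run v (a :: l) = bif Nat.beq a v then run v l + 1 else 0 := rfl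
    cases s with
    | zero => omega
    | succ s =>
      have h0 : a = v := by simpa using h 0 (by omega)
      have := ih s (by simpa using hs) (fun j hj => by simpa using h (j+1) (by omega))
      rw [e, h0]; simp; omega

theorem setn_spec (h s : ℕ) (l : List ℕ) (hs : s ≤ l.length) :
    (setn h s l).length = l.length ∧
      ∀ i, (setn h s l).getD i 0 = if i < s then h else l.getD i 0 := by
  induction s generalizing l with
  | zero => simp [setn]
  | succ s ih =>
    cases l with
    | nil => simp at hs
    | cons a l =>
      have e : setn h (s+1) (a :: l) = h :: setn h s l := rfl
      obtain ⟨h1, h2⟩ := ih l (by simpa using hs)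
      rw [e]
      refine ⟨by simp [h1], fun i => ?_⟩
      cases i with
      | zero => simp
      | succ i =>
        have := h2 i
        simp only [List.getD_cons_succ, this]
        simp

theorem place_spec (v : ℕ) (c : List ℕ) (hv : v ∈ c) :
    ∃ p, p < c.length ∧ c.getD p 0 = v ∧ (∀ i, i < p → c.getD i 0 ≠ v) ∧
      ∀ s, p + s ≤ c.length → (∀ j, j < s → c.getD (p + j) 0 = v) →
        s ≤ frun v c ∧ (place v s c).length = c.length ∧
        ∀ i, (place v s c).getD i 0 = if p ≤ i ∧ i < p + s then v + s else c.getD i 0 := by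
  induction c with
  | nil => simp at hv
  | cons a l ih =>
    have e1 : frun v (a :: l) = bif Nat.beq a v then run v (a :: l) else frun v l := rfl
    have e2 : ∀ s, place v s (a :: l) = bif Nat.beq a v then setn (v + s) s (a :: l)
      else a :: place v s l := fun _ => rfl
    by_cases h : a = v
    · have hb : Nat.beq a v = true := by simpa using h
      rw [hb] at e1 e2
      refine ⟨0, by simp, by simpa using h, by simp, fun s hs hj => ?_⟩
      rw [e1, e2]
      simp only [cond_true]
      obtain ⟨h1, h2⟩ := setn_spec (v + s) s (a :: l) (by simpa using hs)
      refine ⟨run_spec v _ s (by simpa using hs) (fun j hj' => by simpa using hj j hj'), h1, ?_⟩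
      intro i
      rw [h2]; simp
    · have hb : Nat.beq a v = false := by
        cases hh : Nat.beq a v
        · rfl
        · exact absurd (Nat.eq_of_beq_eq_true hh) h
      rw [hb] at e1 e2
      have hvl : v ∈ l := by
        rcases List.mem_cons.1 hv with h' | h'
        · exact absurd h'.symm h
        · exact h'
      obtain ⟨p, h1, h2, h3, h4⟩ := ih hvl
      refine ⟨p + 1, by simpa using h1, by simpa using h2, ?_, fun s hs hj => ?_⟩
      · intro i hi
        cases i with
        | zero => simpa using h
        | succ i => simpa using h3 i (by omega)
      · obtain ⟨g1, g2, g3⟩ := h4 s (by simp at hs; omega) (fun j hj' => by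
          have := hj j hj'
          rw [show p + 1 + j = (p + j) + 1 by omega] at this
          simpa using this)
        rw [e1, e2]
        simp only [cond_false]
        refine ⟨g1, by simp [g2], fun i => ?_⟩
        cases i with
        | zero => simp
        | succ i =>
          simp only [List.getD_cons_succ, g3 i]
          have : (p + 1 ≤ i + 1 ∧ i + 1 < p + 1 + s) ↔ (p ≤ i ∧ i < p + s) := by omega
          simp only [this]

theorem loop_spec (f : List ℕ → Bool) (v : ℕ) (c : List ℕ) (n : ℕ) (h : loop f v c n = true)
    (s : ℕ) (h1 : 1 ≤ s) (h2 : s ≤ n) : f (place v s c) = true := by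
  induction n with
  | zero => omega
  | succ n ih =>
    have e : loop f v c (n+1) = (fL (place v (n+1) c) f && loop f v c n) := rfl
    rw [e, fL_eq, Bool.and_eq_true] at h
    rcases Nat.eq_or_lt_of_le h2 with h' | h'
    · rw [h']; exact h.1
    · exact ih h.2 (by omega)

theorem mn_eq (a b : ℕ) : mn a b = min a b := by
  unfold mn
  cases h : Nat.ble a b
  · have : ¬ a ≤ b := fun h' => by rw [Nat.ble_eq_true_of_le h'] at h; cases h
    simp; omega
  · have := Nat.le_of_ble_eq_true h
    simp; omega

def Cov (t : ℕ × ℕ × ℕ) (i j : ℕ) : Prop :=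
  t.1 ≤ i ∧ i < t.1 + t.2.2 ∧ t.2.1 ≤ j ∧ j < t.2.1 + t.2.2

structure Inv (c : List ℕ) (R : Finset (ℕ × ℕ × ℕ)) : Prop where
  len : c.length = 11
  bd : ∀ t ∈ R, 1 ≤ t.2.2 ∧ t.2.2 ≤ 10 ∧ t.1 + t.2.2 ≤ 11 ∧ t.2.1 + t.2.2 ≤ 11
  abv : ∀ t ∈ R, ∀ i, t.1 ≤ i → i < t.1 + t.2.2 → c.getD i 0 ≤ t.2.1
  ex : ∀ i j, i < 11 → j < 11 → c.getD i 0 ≤ j → ∃ t ∈ R, Cov t i j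
  un : ∀ t ∈ R, ∀ u ∈ R, ∀ i j, Cov t i j → Cov u i j → t = u

theorem mem_getD (c : List ℕ) (v : ℕ) (h : v ∈ c) : ∃ i, i < c.length ∧ c.getD i 0 = v := by
  obtain ⟨p, h1, h2, _⟩ := place_spec v c h
  exact ⟨p, h1, h2⟩

theorem getD_mem (c : List ℕ) (i : ℕ) (h : i < c.length) : c.getD i 0 ∈ c := by
  rw [List.getD_eq_getElem _ _ h]; exact List.getElem_mem h

theorem pop_le (c : List ℕ) (R : Finset (ℕ × ℕ × ℕ)) (I : Inv c R) :
    pop (bits c) 11 ≤ R.card := by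
  rw [pop_bits]
  have : (Finset.range 11).filter (· ∈ c) ⊆ R.image (fun t => t.2.1) := by
    intro v hv
    rw [Finset.mem_filter, Finset.mem_range] at hv
    obtain ⟨i, hi, hc⟩ := mem_getD c v hv.2
    obtain ⟨t, ht, h1, h2, h3, h4⟩ := I.ex i v (I.len ▸ hi) hv.1 hc.le
    have := I.abv t ht i h1 h2
    exact Finset.mem_image.2 ⟨t, ht, by omega⟩
  exact (Finset.card_le_card this).trans Finset.card_image_le

theorem step (c : List ℕ) (R : Finset (ℕ × ℕ × ℕ)) (I : Inv c R) (v : ℕ) (hv : v ∈ c)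
    (hv11 : v < 11) (hmin : ∀ u, u < v → u ∉ c) :
    ∃ s, 1 ≤ s ∧ s ≤ 10 ∧ s ≤ frun v c ∧ s ≤ 11 - v ∧
      ∃ t ∈ R, Inv (place v s c) (R.erase t) := by
  obtain ⟨p, hp, hpv, hpf, hs⟩ := place_spec v c hv
  have hlen := I.len
  have hge : ∀ i, i < 11 → v ≤ c.getD i 0 := by
    intro i hi
    by_contra hlt
    exact hmin _ (not_le.1 hlt) (getD_mem c i (by omega))
  obtain ⟨t, ht, h1, h2, h3, h4⟩ := I.ex p v (by omega) hv11 hpv.le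
  obtain ⟨b1, b2, b3, b4⟩ := I.bd t ht
  have hy := I.abv t ht p h1 h2
  have hy' : t.2.1 = v := by omega
  have hrow : ∀ i, t.1 ≤ i → i < t.1 + t.2.2 → c.getD i 0 = v := by
    intro i g1 g2
    have := I.abv t ht i g1 g2
    have := hge i (by omega)
    omega
  have hx : t.1 = p := by
    by_contra hne
    exact hpf t.1 (by omega) (hrow t.1 le_rfl (by omega))
  obtain ⟨q1, q2, q3⟩ := hs t.2.2 (by omega) (fun j hj => hrow _ (by omega) (by omega))
  refine ⟨t.2.2, b1, b2, q1, by omega, t, ht, ?_⟩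
  refine ⟨by omega, fun u hu => I.bd u (Finset.mem_of_mem_erase hu), ?_, ?_, ?_⟩
  · intro u hu i g1 g2
    have hu' := Finset.mem_of_mem_erase hu
    have hne := Finset.ne_of_mem_erase hu
    have ga := I.abv u hu' i g1 g2
    rw [q3]
    split_ifs with hc
    · by_contra hlt
      have gc := hrow i (by omega) (by omega)
      have gb := I.bd u hu'
      exact hne (I.un u hu' t ht i u.2.1 ⟨g1, g2, le_rfl, by omega⟩
        ⟨by omega, by omega, by omega, by omega⟩)
    · exact ga
  · intro i j hi hj hc
    rw [q3] at hc
    split_ifs at hc with hin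
    · obtain ⟨u, hu, hcov⟩ := I.ex i j hi hj (by
        rw [hrow i (by omega) (by omega)]; omega)
      refine ⟨u, Finset.mem_erase.2 ⟨?_, hu⟩, hcov⟩
      rintro rfl
      have := hcov.2.2.2
      omega
    · obtain ⟨u, hu, hcov⟩ := I.ex i j hi hj hc
      refine ⟨u, Finset.mem_erase.2 ⟨?_, hu⟩, hcov⟩
      rintro rfl
      obtain ⟨w1, w2, _⟩ := hcov
      omega
  · intro u hu w hw
    exact I.un u (Finset.mem_of_mem_erase hu) w (Finset.mem_of_mem_erase hw)

theorem sound (k : ℕ) : ∀ (c : List ℕ) (R : Finset (ℕ × ℕ × ℕ)), Inv c R →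
    search k c = true → k < R.card := by
  induction k with
  | zero =>
    intro c R I h
    have h' : Nat.ble 1 (pop (bits c) 11) = true := h
    have := Nat.le_of_ble_eq_true h'
    have := pop_le c R I
    omega
  | succ k ih =>
    intro c R I h
    have h' : fN (bits c) (fun m => Nat.ble (k+2) (pop m 11) ||
      fN (low m 11 0) (node (search k) c)) = true := h
    rw [fN_eq, fN_eq] at h'
    rw [Bool.or_eq_true] at h'
    rcases h' with h' | h'
    · have := Nat.le_of_ble_eq_true h'
      have := pop_le c R I
      omega
    · unfold node at h'
      rw [Bool.and_eq_true, mn_eq, mn_eq] at h'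
      obtain ⟨g1, g2⟩ := h'
      have g1' := Nat.le_of_ble_eq_true g1
      obtain ⟨l1, l2⟩ := low_spec c 11 0
      obtain ⟨s, s1, s2, s3, s4, t, ht, I'⟩ := step c R I (low (bits c) 11 0)
        (l2.resolve_left (by omega)) (by omega) (fun u hu => l1 u (Nat.zero_le _) hu)
      have hs := loop_spec _ _ _ _ g2 s s1 (le_min s2 (le_min s3 s4))
      have := ih _ _ I' hs
      rw [Finset.card_erase_of_mem ht] at this
      omega

theorem lower (T : Finset (ℕ × ℕ × ℕ)) (hT : IsSquaredTiling 11 T) : 11 ≤ T.card := by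
  refine sound 10 [0,0,0,0,0,0,0,0,0,0,0] T ?_ search_ok
  have hz : ∀ i, ([0,0,0,0,0,0,0,0,0,0,0] : List ℕ).getD i 0 = 0 := by
    intro i
    by_cases hi : i < 11
    · interval_cases i <;> rfl
    · exact List.getD_eq_default _ _ (by simpa using hi)
  obtain ⟨h1, h2⟩ := hT
  refine ⟨rfl, h1, ?_, ?_, ?_⟩
  · intro t _ i _ _
    rw [hz]; exact Nat.zero_le _
  · intro i j hi hj _
    obtain ⟨t, ht, _⟩ := h2 i j hi hj
    exact ⟨t, ht.1, ht.2⟩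
  · intro t ht u hu i j c1 c2
    have := h1 t ht
    refine (h2 i j ?_ ?_).unique ⟨ht, c1⟩ ⟨hu, c2⟩
    · have := c1.2.1; omega
    · have := c1.2.2.2; omega

def W : Finset (ℕ × ℕ × ℕ) :=
  {(0,0,7),(7,0,4),(7,4,4),(0,7,4),(4,7,2),(6,7,1),(6,8,3),(9,8,2),(4,9,2),(9,10,1),(10,10,1)}

theorem W_ok : IsSquaredTiling 11 W := by
  refine ⟨by decide +kernel, fun i j hi hj => ?_⟩
  have h : ∀ i < 11, ∀ j < 11, (W.filter (fun t => t.1 ≤ i ∧ i < t.1 + t.2.2 ∧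
    t.2.1 ≤ j ∧ j < t.2.1 + t.2.2)).card = 1 := by decide +kernel
  obtain ⟨t, ht⟩ := Finset.card_eq_one.1 (h i hi j hj)
  refine ⟨t, ?_, fun u hu => ?_⟩
  · exact Finset.mem_filter.1 (ht ▸ Finset.mem_singleton_self t)
  · exact Finset.mem_singleton.1 (ht ▸ Finset.mem_filter.2 hu)

end SqT

theorem s_11 : s 11 = 11 := by
  refine le_antisymm (Nat.sInf_le ⟨SqT.W, SqT.W_ok, by decide +kernel⟩) ?_
  refine le_csInf ⟨_, SqT.W, SqT.W_ok, rfl⟩ ?_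
  rintro k ⟨T, hT, rfl⟩
  exact SqT.lower T hT
end

section
/- s(17) = 12: the minimum number of squares in a squared tiling of the 17×17 square by strictly smaller integer squares equals 12. -/
namespace S17

inductive E
  | nil
  | cons (mb m q qt : Nat) (r : E)

noncomputable section

def force (n : Nat) (k : Nat → Bool) : Bool :=
  Nat.rec false (fun m _ => k m) (Nat.succ n)

theorem force_eq (n : Nat) (k : Nat → Bool) : force n k = k n := rfl

def forceA (n : Nat) (k : Nat → Bool) : Bool :=
  Nat.rec false (fun m _ => k m) (Nat.add n (nat_lit 1))

theorem forceA_eq (n : Nat) (k : Nat → Bool) : forceA n k = k n := rfl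

def go (f : Nat → Nat → Bool) (tb F idx : Nat) : Bool :=
  Bool.rec (f F idx) false (Nat.beq (Nat.land tb (Nat.pow (nat_lit 2) idx)) (nat_lit 0))

def tryK (f : Nat → Nat → Bool) (tb F idx : Nat) (l : E) : Bool :=
  E.rec false (fun mb m q qt _ ih =>
    Bool.rec (Bool.rec false (go f tb (Nat.xor F m) (Nat.sub idx qt)) (Nat.beq (Nat.land F m) m))
     (Bool.rec (go f tb (Nat.xor F m) (Nat.sub idx q)) true ih) (Nat.beq (Nat.land F mb) mb)) l

def sqs : E :=
  (E.cons (nat_lit 262145)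
    (nat_lit 1) (nat_lit 1) (nat_lit 291)
  (E.cons (nat_lit 68720263171)
    (nat_lit 786435) (nat_lit 4) (nat_lit 584)
  (E.cons (nat_lit 18014879547654151)
    (nat_lit 481038172167) (nat_lit 9) (nat_lit 879)
  (E.cons (nat_lit 4722636699878083526671)
    (nat_lit 270217008438312975) (nat_lit 16) (nat_lit 1176)
  (E.cons (nat_lit 1238086433204797718006595615)
    (nat_lit 146393919417443107471391) (nat_lit 25) (nat_lit 1475)
  (E.cons (nat_lit 324596544178411929072697754779711)
    (nat_lit 77990519985202289541734203455) (nat_lit 36) (nat_lit 1776)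
  (E.cons (nat_lit 85111805743768220792219569367797203071)
    (nat_lit 41214013533604926375917509855150207) (nat_lit 49) (nat_lit 2079)
  (E.cons (nat_lit 22322438282174379827394549552367924233896191)
    (nat_lit 21693083643756685858831279719562727915775) (nat_lit 64) (nat_lit 2384)
  (E.cons (nat_lit 5857402273591299025003462019619255143104478183935)
    (nat_lit 11395724267687352188722688754123064480748012031) (nat_lit 81) (nat_lit 2691)
  (E.cons (nat_lit 1538476028379596278743787756098916494494261146887652351)
    (nat_lit 5980487513707420385440728948607310875522024704050175) (nat_lit 100) (nat_lit 3000)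
  (E.cons (nat_lit 404871541403721099643544711451013137829677703512468422920191)
    (nat_lit 3137030338973530758054188365722487199126955066770214094847) (nat_lit 121) (nat_lit 3311)
  (E.cons (nat_lit 106957400766960507326460366496320895693258993790608157693034893311)
    (nat_lit 1645109098403320628542338812650463374363898390059046438723915775) (nat_lit 144) (nat_lit 3624)
  (E.cons (nat_lit 28469601658839339916189061562167174384407260050929596121251466924793855)
    (nat_lit 862616271677084766450038113059072574602824162248049900601370029596671) (nat_lit 169) (nat_lit 3939)
  (E.cons (nat_lit 7689292544267997487665494637118340043110982304739732641071372076354321006591)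
    (nat_lit 452286966935735273692308074075345802281608263137197388605273075859750404095) (nat_lit 196) (nat_lit 4256)
  (E.cons (nat_lit 2134273456418175743955449466860212481079596379442360308726609251662991813024448511)
    (nat_lit 237135866353987198135662448477869798811620950680505307504136195277343097003737087) (nat_lit 225) (nat_lit 4575)
  (E.cons (nat_lit 621652622653612979664501223791037560577384368764274862786556783970568421289421847724031)
    (nat_lit 124329386243826337509118975644216720476928217966927145346092807077408924276888472190975) (nat_lit 256) (nat_lit 4896) E.nil))))))))))))))))

def norm (F : Nat) : Nat :=
  Nat.div F (Nat.gcd F (nat_lit 34175792574734561318320347298712833833643272357706444319152665725155515612490248800367393390985216))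

def search (ts : List Nat) : Nat → Nat → Bool :=
  List.rec (fun F _ => Nat.beq F (nat_lit 0)) (fun tb _ ih F idx =>
    Bool.rec (forceA (norm F) fun X => forceA idx fun idx => tryK ih tb X idx sqs) true
      (Nat.beq F (nat_lit 0))) ts

def step1 (t : Nat) (k : Nat) : Nat :=
  t * 2 ^ (k * k) ||| t * 2 ^ (k * k + 290 * k)

def stepN (t : Nat) : Nat → Nat
  | 0 => t
  | k + 1 => stepN t k ||| step1 t (k + 1)

def tab : Nat → Nat
  | 0 => 1
  | b + 1 => stepN (tab b) 16 % 2 ^ 5220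

def tabs : Nat → List Nat
  | 0 => []
  | b + 1 => tab b :: tabs b

def full : Nat := nat_lit 65184902580136777453720497853585099417567239578688073073308431465226991092044950834599821311

def build (n : Nat) : Nat → List Nat → (List Nat → Bool) → Bool :=
  Nat.rec (fun _ acc k => k acc)
    (fun _ ih t acc k => forceA (stepN t 16 % 2 ^ 5220) fun t' => ih t' (t :: acc) k) n

theorem build_eq (n b : Nat) (k : List Nat → Bool) :
    build n (tab b) (tabs b) k = k (tabs (b + n)) := by
  induction n generalizing b with
  | zero => rfl
  | succ n ih =>
    have : build (n + 1) (tab b) (tabs b) k = build n (tab (b + 1)) (tabs (b + 1)) k := rfl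
    rw [this, ih, Nat.add_right_comm, Nat.add_assoc]

theorem compute : build 11 (nat_lit 1) [] (fun ts => search ts full (nat_lit 5219)) = false := by
  decide +kernel

theorem search_false : search (tabs 11) full 5219 = false := by
  have h := build_eq 11 0 (fun ts => search ts full 5219)
  rw [Nat.zero_add] at h
  rw [← h]
  exact compute

def wt (t : ℕ × ℕ × ℕ) : ℕ := t.2.2 * t.2.2 + 290 * (if t.1 + t.2.2 = 17 then t.2.2 else 0)

def C (t : ℕ × ℕ × ℕ) (n : ℕ) : Prop :=
  t.1 ≤ n / 18 ∧ n / 18 < t.1 + t.2.2 ∧ t.2.1 ≤ n % 18 ∧ n % 18 < t.2.1 + t.2.2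

def Cov (T : Finset (ℕ × ℕ × ℕ)) (n : ℕ) : Prop := ∃ t ∈ T, C t n

def IsMask (m k : ℕ) : Prop := ∀ c, m.testBit c = decide (c / 18 < k ∧ c % 18 < k)

def IsMaskB (m k : ℕ) : Prop :=
  ∀ c, m.testBit c = decide ((c / 18 < k ∧ c % 18 < k) ∨ c = 18 * k)

def Good : E → ℕ → Prop
  | E.nil, k => k = 17
  | E.cons mb m q qt r, k =>
    IsMask m k ∧ IsMaskB mb k ∧ q = k * k ∧ qt = k * k + 290 * k ∧ Good r (k + 1)

theorem testBit_eq_of (m : ℕ) (P : ℕ → Bool) (N : ℕ) (hm : m < 2 ^ N)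
    (h : ∀ c < N, m.testBit c = P c) (hP : ∀ c, N ≤ c → P c = false) (c : ℕ) :
    m.testBit c = P c := by
  rcases lt_or_ge c N with hc | hc
  · exact h c hc
  · rw [hP c hc]
    exact Nat.testBit_eq_false_of_lt (lt_of_lt_of_le hm (Nat.pow_le_pow_right (by norm_num) hc))

theorem isMask_of (m k : ℕ) (hk : k ≤ 16) (hm : m < 2 ^ 324)
    (h : ∀ c < 324, m.testBit c = decide (c / 18 < k ∧ c % 18 < k)) : IsMask m k := by
  refine testBit_eq_of m _ 324 hm h ?_
  intro c hc
  simp only [decide_eq_false_iff_not]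
  omega

theorem isMaskB_of (m k : ℕ) (hk : k ≤ 16) (hm : m < 2 ^ 324)
    (h : ∀ c < 324, m.testBit c = decide ((c / 18 < k ∧ c % 18 < k) ∨ c = 18 * k)) :
    IsMaskB m k := by
  refine testBit_eq_of m _ 324 hm h ?_
  intro c hc
  simp only [decide_eq_false_iff_not]
  omega

def ball (m : ℕ) (P : ℕ → Bool) : Bool := (List.range 324).all fun c => m.testBit c == P c

theorem ball_iff (m : ℕ) (P : ℕ → Bool) (h : ball m P = true) : ∀ c < 324, m.testBit c = P c := by
  intro c hc
  have := List.all_eq_true.1 h c (List.mem_range.2 hc)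
  simpa using this

def chk : E → ℕ → Bool
  | E.nil, k => decide (k = 17)
  | E.cons mb m q qt r, k =>
    (decide (k ≤ 16) && decide (m < 2 ^ 324) && decide (mb < 2 ^ 324)) &&
    ball m (fun c => decide (c / 18 < k ∧ c % 18 < k)) &&
    ball mb (fun c => decide ((c / 18 < k ∧ c % 18 < k) ∨ c = 18 * k)) &&
    (decide (q = k * k ∧ qt = k * k + 290 * k)) && chk r (k + 1)

theorem good_of_chk (l : E) (k : ℕ) (h : chk l k = true) : Good l k := by
  induction l generalizing k with
  | nil => simpa [chk, Good] using h
  | cons mb m q qt r ih =>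
    simp only [chk, Bool.and_eq_true, decide_eq_true_eq] at h
    obtain ⟨⟨⟨⟨⟨⟨h1, h2⟩, h3⟩, h4⟩, h5⟩, h6⟩, h7⟩ := h
    exact ⟨isMask_of m k h1 h2 (ball_iff _ _ h4), isMaskB_of mb k h1 h3 (ball_iff _ _ h5), h6.1, h6.2, ih _ h7⟩

theorem good_sqs : Good sqs 1 := good_of_chk _ _ (by decide +kernel)

theorem full_testBit (c : ℕ) : full.testBit c = decide (c / 18 < 17 ∧ c % 18 < 17) := by
  refine testBit_eq_of full (fun c => decide (c / 18 < 17 ∧ c % 18 < 17)) 324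
    (by decide +kernel) (by decide +kernel) ?_ c
  intro c hc
  simp only [decide_eq_false_iff_not]
  omega

theorem stepN_testBit (t n i : ℕ) :
    (t.testBit i = true → (stepN t n).testBit i = true) ∧
    (∀ k, 1 ≤ k → k ≤ n → t.testBit i = true → (stepN t n).testBit (i + k * k) = true ∧
      (stepN t n).testBit (i + (k * k + 290 * k)) = true) := by
  induction n with
  | zero => exact ⟨fun h => h, fun k h1 h2 => by omega⟩
  | succ n ih =>
    refine ⟨fun h => ?_, fun k h1 h2 h => ?_⟩
    · simp [stepN, ih.1 h]
    · rcases Nat.lt_or_ge n k with hk | hk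
      · obtain rfl : k = n + 1 := by omega
        simp only [stepN, step1, Nat.testBit_or, Bool.or_eq_true, Nat.testBit_mul_two_pow]
        constructor
        · right; left; simp [h]
        · right; right; simp [h]
      · have := ih.2 k h1 hk h
        simp [stepN, this.1, this.2]

theorem tab_mono (b i : ℕ) (hi : i < 5220) (h : (tab b).testBit i = true) :
    (tab (b + 1)).testBit i = true := by
  simp only [tab, Nat.testBit_mod_two_pow, hi, decide_true, Bool.true_and]
  exact (stepN_testBit _ 16 i).1 h

theorem tab_add (b i : ℕ) (t : ℕ × ℕ × ℕ) (h1 : 1 ≤ t.2.2) (h2 : t.2.2 ≤ 16)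
    (hi : i + wt t < 5220) (h : (tab b).testBit i = true) :
    (tab (b + 1)).testBit (i + wt t) = true := by
  simp only [tab, Nat.testBit_mod_two_pow, hi, decide_true, Bool.true_and]
  have := (stepN_testBit (tab b) 16 i).2 _ h1 h2 h
  unfold wt
  split_ifs
  · exact this.2
  · simpa using this.1

theorem tab_sound (S : Finset (ℕ × ℕ × ℕ)) : ∀ b : ℕ, S.card ≤ b →
    (∀ t ∈ S, 1 ≤ t.2.2 ∧ t.2.2 ≤ 16) → ∑ t ∈ S, wt t < 5220 →
    (tab b).testBit (∑ t ∈ S, wt t) = true := by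
  induction S using Finset.induction_on with
  | empty =>
    intro b hb hS hw
    clear hb hS hw
    simp only [Finset.sum_empty]
    induction b with
    | zero => rfl
    | succ b ih => exact tab_mono b 0 (by norm_num) ih
  | insert a S ha ih =>
    intro b hb hS hw
    rw [Finset.card_insert_of_notMem ha] at hb
    rw [Finset.sum_insert ha] at hw ⊢
    obtain ⟨b, rfl⟩ : ∃ c, b = c + 1 := ⟨b - 1, by omega⟩
    have := ih b (by omega) (fun t ht => hS t (Finset.mem_insert_of_mem ht)) (by omega)
    have h2 := hS a (Finset.mem_insert_self _ _)
    rw [Nat.add_comm (wt a)] at hw ⊢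
    exact tab_add b _ a h2.1 h2.2 hw this

theorem go_eq (f : Nat → Nat → Bool) (tb F idx : Nat) (ht : tb.testBit idx = true)
    (hf : f F idx = true) : go f tb F idx = true := by
  have h : Nat.beq (Nat.land tb (Nat.pow 2 idx)) 0 = false := by
    have h1 : Nat.land tb (Nat.pow 2 idx) = 2 ^ idx := by
      have := Nat.and_two_pow tb idx
      rw [ht] at this
      simpa using this
    rw [h1]
    have : 2 ^ idx ≠ 0 := by positivity
    rw [Bool.eq_false_iff]
    intro hh
    exact this (Nat.eq_of_beq_eq_true hh)
  unfold go
  change (Bool.rec (f F idx) false (Nat.beq (Nat.land tb (Nat.pow 2 idx)) 0) : Bool) = true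
  rw [h]
  exact hf

theorem land_beq (F m : ℕ) (h : ∀ c, m.testBit c = true → F.testBit c = true) :
    Nat.beq (Nat.land F m) m = true := by
  have : Nat.land F m = m := by
    change F &&& m = m
    apply Nat.eq_of_testBit_eq
    intro c
    rw [Nat.testBit_and]
    have := h c
    cases hm : m.testBit c <;> simp_all
  rw [this]
  exact Nat.beq_refl m

theorem land_beq_false (F m c : ℕ) (h1 : m.testBit c = true) (h2 : F.testBit c = false) :
    Nat.beq (Nat.land F m) m = false := by
  rw [Bool.eq_false_iff]
  intro hh
  have h3 : F &&& m = m := Nat.eq_of_beq_eq_true hh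
  have h4 : (F &&& m).testBit c = true := by rw [h3, h1]
  rw [Nat.testBit_and, h2] at h4
  simp at h4

theorem tryK_sound (f : Nat → Nat → Bool) (tb F idx h : ℕ) (bot : Prop) [Decidable bot]
    (hh : h ≤ 16)
    (hfit : ∀ c, c / 18 < h → c % 18 < h → F.testBit c = true)
    (hbot : F.testBit (18 * h) = !(decide bot))
    (hgo : ∀ m, IsMask m h →
      go f tb (F ^^^ m) (idx - (h * h + 290 * (if bot then h else 0))) = true)
    (l : E) (k : ℕ) (hl : Good l k) (h1 : 1 ≤ k) (hk : k ≤ h) : tryK f tb F idx l = true := by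
  induction l generalizing k with
  | nil => simp only [Good] at hl; omega
  | cons mb m q qt r ih =>
    obtain ⟨g1, g2, g3, g4, g5⟩ := hl
    change (Bool.rec (Bool.rec false (go f tb (Nat.xor F m) (Nat.sub idx qt))
      (Nat.beq (Nat.land F m) m))
      (Bool.rec (go f tb (Nat.xor F m) (Nat.sub idx q)) true (tryK f tb F idx r))
      (Nat.beq (Nat.land F mb) mb) : Bool) = true
    rcases Nat.lt_or_ge k h with hlt | hge
    · have e : Nat.beq (Nat.land F mb) mb = true := by
        apply land_beq
        intro c hc
        rw [g2 c] at hc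
        simp only [decide_eq_true_eq] at hc
        apply hfit <;> omega
      rw [e, ih (k + 1) g5 (by omega) (by omega)]
    · obtain rfl : k = h := by omega
      have hm := hgo m g1
      by_cases hb : bot
      · have e : Nat.beq (Nat.land F mb) mb = false := by
          apply land_beq_false F mb (18 * k)
          · rw [g2]; simp
          · rw [hbot]; simp [hb]
        have e2 : Nat.beq (Nat.land F m) m = true := by
          apply land_beq
          intro c hc
          rw [g1 c] at hc
          simp only [decide_eq_true_eq] at hc
          exact hfit c hc.1 hc.2
        rw [e, e2, g4]
        rw [if_pos hb] at hm
        exact hm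
      · have e : Nat.beq (Nat.land F mb) mb = true := by
          apply land_beq
          intro c hc
          rw [g2 c] at hc
          simp only [decide_eq_true_eq] at hc
          rcases hc with hc | rfl
          · exact hfit c hc.1 hc.2
          · rw [hbot]; simp [hb]
        rw [if_neg hb] at hm
        simp only [Nat.mul_zero, Nat.add_zero] at hm
        have hm' : go f tb (Nat.xor F m) (Nat.sub idx q) = true := by rw [g3]; exact hm
        rw [e, hm']
        cases tryK f tb F idx r <;> rfl

structure Inv (p F : ℕ) (T : Finset (ℕ × ℕ × ℕ)) : Prop where
  bits : ∀ c, F.testBit c = true ↔ Cov T (p + c)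
  low : ∀ n, n < p → ¬ Cov T n
  bd : ∀ t ∈ T, 1 ≤ t.2.2 ∧ t.2.2 ≤ 16 ∧ t.1 + t.2.2 ≤ 17 ∧ t.2.1 + t.2.2 ≤ 17
  disj : ∀ t ∈ T, ∀ u ∈ T, ∀ n, C t n → C u n → t = u
  down : ∀ n, Cov T n → n / 18 + 1 < 17 → Cov T (n + 18)

theorem Inv.normalize {p F : ℕ} {T : Finset (ℕ × ℕ × ℕ)} (h : Inv p F T) (hF : F ≠ 0) :
    ∃ p', Inv p' (norm F) T ∧ (norm F).testBit 0 = true := by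
  obtain ⟨v, hv, hg⟩ := (Nat.dvd_prime_pow Nat.prime_two).1 (Nat.gcd_dvd_right F (2 ^ 324))
  have hd : 2 ^ v ∣ F := hg ▸ Nat.gcd_dvd_left F (2 ^ 324)
  obtain ⟨G, hG⟩ := hd
  have hn : norm F = G := by
    have : norm F = F / Nat.gcd F (2 ^ 324) := by
      have e : (2 ^ 324 : ℕ) = nat_lit 34175792574734561318320347298712833833643272357706444319152665725155515612490248800367393390985216 := by decide +kernel
      rw [e]
      rfl
    rw [this, hg]
    exact Nat.div_eq_of_eq_mul_right (by positivity) hG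
  have hb : ∀ c, F.testBit (v + c) = G.testBit c := by
    intro c
    rw [hG, Nat.mul_comm, Nat.testBit_mul_two_pow]
    simp
  have hlow : ∀ c, c < v → F.testBit c = false := by
    intro c hc
    rw [hG, Nat.mul_comm, Nat.testBit_mul_two_pow]
    simp [hc]
  have hvlt : v < 324 := by
    by_contra hcon
    apply hF
    apply Nat.eq_of_testBit_eq
    intro c
    rw [Nat.zero_testBit, Bool.eq_false_iff]
    intro hc
    obtain ⟨t, ht, ht2⟩ := (h.bits c).1 hc
    have hbd := h.bd t ht
    obtain ⟨a1, a2, a3, a4⟩ := ht2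
    rcases Nat.lt_or_ge c v with hcv | hcv
    · rw [hlow c hcv] at hc; simp at hc
    · omega
  rw [hn]
  refine ⟨p + v, ⟨?_, ?_, h.bd, h.disj, h.down⟩, ?_⟩
  · intro c
    rw [← hb c, h.bits, Nat.add_assoc]
  · intro n hnp hcov
    rcases Nat.lt_or_ge n p with h1 | h1
    · exact h.low n h1 hcov
    · obtain ⟨c, rfl⟩ := Nat.exists_eq_add_of_le h1
      have := (h.bits c).2 hcov
      rw [hlow c (by omega)] at this
      simp at this
  · by_contra hcon
    have h2 : 2 ∣ G := by
      rw [Nat.testBit_zero] at hcon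
      simp only [decide_eq_true_eq] at hcon
      omega
    obtain ⟨H, rfl⟩ := h2
    have h3 : 2 ^ (v + 1) ∣ Nat.gcd F (2 ^ 324) := by
      apply Nat.dvd_gcd
      · exact ⟨H, by rw [hG, pow_succ]; ring⟩
      · exact pow_dvd_pow 2 (by omega)
    rw [hg] at h3
    have := (Nat.pow_dvd_pow_iff_le_right (by norm_num : 1 < 2)).1 h3
    omega

theorem C_corner (x y h c : ℕ) (hy : y + h ≤ 17) :
    C (x, y, h) (18 * x + y + c) ↔ c / 18 < h ∧ c % 18 < h := by
  simp only [C]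
  constructor
  · rintro ⟨a1, a2, a3, a4⟩
    omega
  · rintro ⟨a1, a2⟩
    have e1 : (18 * x + y + c) / 18 = x + c / 18 := by omega
    have e2 : (18 * x + y + c) % 18 = y + c % 18 := by omega
    omega

theorem search_sound (b : ℕ) : ∀ (p F : ℕ) (T : Finset (ℕ × ℕ × ℕ)), Inv p F T → T.card ≤ b →
    ∑ t ∈ T, wt t < 5220 → search (tabs b) F (∑ t ∈ T, wt t) = true := by
  induction b with
  | zero =>
    intro p F T h hc _
    have hT : T = ∅ := by simpa using hc
    subst hT
    have hF : F = 0 := by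
      apply Nat.eq_of_testBit_eq
      intro c
      rw [Nat.zero_testBit, Bool.eq_false_iff]
      intro hc
      obtain ⟨t, ht, _⟩ := (h.bits c).1 hc
      simp at ht
    subst hF
    rfl
  | succ b ih =>
    intro p F T h hc hw
    have hs : search (tabs (b + 1)) F (∑ t ∈ T, wt t) =
      Bool.rec (tryK (search (tabs b)) (tab b) (norm F) (∑ t ∈ T, wt t) sqs) true
        (Nat.beq F 0) := rfl
    rw [hs]
    by_cases hF : F = 0
    · subst hF; rfl
    have hF' : Nat.beq F 0 = false := by
      rw [Bool.eq_false_iff]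
      intro hh
      exact hF (Nat.eq_of_beq_eq_true hh)
    rw [hF']
    change tryK (search (tabs b)) (tab b) (norm F) (∑ t ∈ T, wt t) sqs = true
    obtain ⟨p', h', h0⟩ := h.normalize hF
    clear h hs hF hF'
    generalize norm F = F at *
    obtain ⟨t, ht, htc⟩ := (h'.bits 0).1 h0
    obtain ⟨x, y, k⟩ := t
    obtain ⟨bd1, bd2, bd3, bd4⟩ := h'.bd _ ht
    simp only at bd1 bd2 bd3 bd4
    have hp : p' = 18 * x + y := by
      have hcc : C (x, y, k) (18 * x + y) := by
        have := (C_corner x y k 0 bd4).2 (by omega)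
        simpa using this
      have : ¬ (18 * x + y < p') := fun hlt => h'.low _ hlt ⟨_, ht, hcc⟩
      simp only [C] at htc
      omega
    subst hp
    have hmem : ∀ c, c / 18 < k → c % 18 < k → F.testBit c = true := by
      intro c h1 h2
      exact (h'.bits c).2 ⟨_, ht, (C_corner x y k c bd4).2 ⟨h1, h2⟩⟩
    have hsum : ∑ u ∈ T.erase (x, y, k), wt u + wt (x, y, k) = ∑ u ∈ T, wt u :=
      Finset.sum_erase_add _ _ ht
    have hcard : (T.erase (x, y, k)).card ≤ b := by
      rw [Finset.card_erase_of_mem ht]; omega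
    apply tryK_sound (search (tabs b)) (tab b) F _ k (x + k = 17) bd2 hmem ?_ ?_ sqs 1 good_sqs
      le_rfl bd1
    · by_cases hb : x + k = 17
      · simp only [hb, decide_true, Bool.not_true]
        rw [Bool.eq_false_iff]
        intro hh
        obtain ⟨u, hu, hu2⟩ := (h'.bits _).1 hh
        have := h'.bd u hu
        simp only [C] at hu2
        omega
      · simp only [hb, decide_false, Bool.not_false]
        rw [h'.bits]
        have h1 : Cov T (18 * x + y + 18 * (k - 1)) :=
          ⟨_, ht, (C_corner x y k _ bd4).2 (by omega)⟩
        have h2 := h'.down _ h1 (by omega)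
        have e : 18 * x + y + 18 * (k - 1) + 18 = 18 * x + y + 18 * k := by omega
        rwa [e] at h2
    · intro m hm
      have e : ∑ t ∈ T, wt t - (k * k + 290 * (if x + k = 17 then k else 0)) =
          ∑ u ∈ T.erase (x, y, k), wt u := by
        rw [← hsum]
        simp only [wt]
        omega
      rw [e]
      have hinv : Inv (18 * x + y) (F ^^^ m) (T.erase (x, y, k)) := by
        refine ⟨?_, ?_, ?_, ?_, ?_⟩
        · intro c
          rw [Nat.testBit_xor, hm c]
          by_cases hcc : c / 18 < k ∧ c % 18 < k
          · rw [hmem c hcc.1 hcc.2]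
            simp only [hcc, and_self, decide_true, Bool.xor_self, Bool.false_eq_true, false_iff]
            rintro ⟨u, hu, hu2⟩
            have := h'.disj _ ht u (Finset.mem_of_mem_erase hu) _
              ((C_corner x y k c bd4).2 hcc) hu2
            exact (Finset.ne_of_mem_erase hu) this.symm
          · simp only [hcc, decide_false, Bool.xor_false]
            rw [h'.bits]
            constructor
            · rintro ⟨u, hu, hu2⟩
              refine ⟨u, Finset.mem_erase.2 ⟨?_, hu⟩, hu2⟩
              rintro rfl
              exact hcc ((C_corner x y k c bd4).1 hu2)
            · rintro ⟨u, hu, hu2⟩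
              exact ⟨u, Finset.mem_of_mem_erase hu, hu2⟩
        · rintro n hn ⟨u, hu, hu2⟩
          exact h'.low n hn ⟨u, Finset.mem_of_mem_erase hu, hu2⟩
        · intro u hu
          exact h'.bd u (Finset.mem_of_mem_erase hu)
        · intro u hu v hv
          exact h'.disj u (Finset.mem_of_mem_erase hu) v (Finset.mem_of_mem_erase hv)
        · rintro n ⟨u, hu, hu2⟩ hn
          have hcn : Cov T n := ⟨u, Finset.mem_of_mem_erase hu, hu2⟩
          obtain ⟨v, hv, hv2⟩ := h'.down n hcn hn
          refine ⟨v, Finset.mem_erase.2 ⟨?_, hv⟩, hv2⟩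
          rintro rfl
          have hnp : ¬ n < 18 * x + y := fun hlt => h'.low n hlt hcn
          have hnc : ¬ C (x, y, k) n := by
            intro hh
            exact (Finset.ne_of_mem_erase hu)
              (h'.disj _ ht u (Finset.mem_of_mem_erase hu) _ hh hu2).symm
          simp only [C] at hv2 hnc
          omega
      apply go_eq
      · exact tab_sound _ b hcard (fun u hu => by
          have := h'.bd u (Finset.mem_of_mem_erase hu)
          omega) (by omega)
      · exact ih _ _ _ hinv hcard (by omega)

theorem sum_ind (x h : ℕ) (hx : x + h ≤ 17) :
    ∑ i ∈ Finset.range 17, (if x ≤ i ∧ i < x + h then 1 else 0) = h := by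
  rw [← Finset.sum_filter, ← Finset.card_eq_sum_ones]
  have : (Finset.range 17).filter (fun i => x ≤ i ∧ i < x + h) = Finset.Ico x (x + h) := by
    ext i
    simp only [Finset.mem_filter, Finset.mem_range, Finset.mem_Ico]
    omega
  rw [this]
  simp

theorem cell_sum {T : Finset (ℕ × ℕ × ℕ)} (hT : IsSquaredTiling 17 T) (i j : ℕ)
    (hi : i < 17) (hj : j < 17) :
    ∑ t ∈ T, (if t.1 ≤ i ∧ i < t.1 + t.2.2 then 1 else 0) *
      (if t.2.1 ≤ j ∧ j < t.2.1 + t.2.2 then 1 else 0) = 1 := by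
  obtain ⟨t, ⟨ht, h1, h2, h3, h4⟩, hu⟩ := hT.2 i j hi hj
  rw [Finset.sum_eq_single t]
  · simp [h1, h2, h3, h4]
  · intro u hu1 hne
    by_contra hcon
    apply hne
    apply hu
    by_cases c1 : u.1 ≤ i ∧ i < u.1 + u.2.2
    · by_cases c2 : u.2.1 ≤ j ∧ j < u.2.1 + u.2.2
      · exact ⟨hu1, c1.1, c1.2, c2.1, c2.2⟩
      · simp [c2] at hcon
    · simp [c1] at hcon
  · intro h; exact absurd ht h

theorem wt_total {T : Finset (ℕ × ℕ × ℕ)} (hT : IsSquaredTiling 17 T) :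
    ∑ t ∈ T, wt t = 5219 := by
  have hA : ∑ t ∈ T, t.2.2 * t.2.2 = 289 := by
    have : ∑ i ∈ Finset.range 17, ∑ j ∈ Finset.range 17, ∑ t ∈ T,
        (if t.1 ≤ i ∧ i < t.1 + t.2.2 then 1 else 0) *
        (if t.2.1 ≤ j ∧ j < t.2.1 + t.2.2 then 1 else 0) = 289 := by
      rw [Finset.sum_congr rfl (fun i hi => Finset.sum_congr rfl (fun j hj =>
        cell_sum hT i j (Finset.mem_range.1 hi) (Finset.mem_range.1 hj)))]
      simp
    rw [← this]
    rw [Finset.sum_congr rfl (fun i _ => Finset.sum_comm), Finset.sum_comm]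
    apply Finset.sum_congr rfl
    intro t ht
    obtain ⟨_, _, h3, h4⟩ := hT.1 t ht
    rw [← Finset.sum_mul_sum, sum_ind _ _ h3, sum_ind _ _ h4]
  have hB : ∑ t ∈ T, (if t.1 + t.2.2 = 17 then t.2.2 else 0) = 17 := by
    have : ∑ j ∈ Finset.range 17, ∑ t ∈ T,
        (if t.1 ≤ 16 ∧ 16 < t.1 + t.2.2 then 1 else 0) *
        (if t.2.1 ≤ j ∧ j < t.2.1 + t.2.2 then 1 else 0) = 17 := by
      rw [Finset.sum_congr rfl (fun j hj =>
        cell_sum hT 16 j (by norm_num) (Finset.mem_range.1 hj))]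
      simp
    refine Eq.trans ?_ this
    rw [Finset.sum_comm]
    apply Finset.sum_congr rfl
    intro t ht
    obtain ⟨h1, _, h3, h4⟩ := hT.1 t ht
    rw [← Finset.mul_sum, sum_ind _ _ h4]
    by_cases h : t.1 + t.2.2 = 17
    · rw [if_pos h, if_pos (by omega)]; simp
    · rw [if_neg h, if_neg (by omega)]; simp
  simp only [wt, Finset.sum_add_distrib, ← Finset.mul_sum]
  norm_num [hA, hB]

theorem inv_full {T : Finset (ℕ × ℕ × ℕ)} (hT : IsSquaredTiling 17 T) : Inv 0 full T := by
  have hcov : ∀ n, Cov T n ↔ n / 18 < 17 ∧ n % 18 < 17 := by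
    intro n
    constructor
    · rintro ⟨t, ht, h1, h2, h3, h4⟩
      have := hT.1 t ht
      omega
    · rintro ⟨h1, h2⟩
      obtain ⟨t, ⟨ht, ht2⟩, _⟩ := hT.2 _ _ h1 h2
      exact ⟨t, ht, ht2⟩
  refine ⟨?_, ?_, ?_, ?_, ?_⟩
  · intro c
    rw [hcov, full_testBit, Nat.zero_add]
    simp
  · intro n hn; omega
  · exact hT.1
  · intro t ht u hu n h1 h2
    have hb := (hcov n).1 ⟨t, ht, h1⟩
    exact (hT.2 _ _ hb.1 hb.2).unique ⟨ht, h1⟩ ⟨hu, h2⟩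
  · intro n h1 h2
    rw [hcov] at h1 ⊢
    omega

theorem lower {T : Finset (ℕ × ℕ × ℕ)} (hT : IsSquaredTiling 17 T) : 12 ≤ T.card := by
  by_contra hcon
  have h := search_sound 11 0 full T (inv_full hT) (by omega) (by rw [wt_total hT]; norm_num)
  rw [wt_total hT, search_false] at h
  exact Bool.false_ne_true h

def sol : Finset (ℕ × ℕ × ℕ) :=
  {(0, 0, 9), (0, 9, 8), (8, 9, 2), (8, 11, 4), (8, 15, 2), (9, 0, 8), (9, 8, 1), (10, 8, 3),
    (10, 15, 2), (12, 11, 1), (12, 12, 5), (13, 8, 4)}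

theorem sol_cells : ∀ i < 17, ∀ j < 17, (sol.filter (fun t : ℕ × ℕ × ℕ =>
    t.1 ≤ i ∧ i < t.1 + t.2.2 ∧ t.2.1 ≤ j ∧ j < t.2.1 + t.2.2)).card = 1 := by
  decide +kernel

theorem sol_tiling : IsSquaredTiling 17 sol := by
  refine ⟨by decide +kernel, ?_⟩
  intro i j hi hj
  obtain ⟨t, ht⟩ := Finset.card_eq_one.1 (sol_cells i hi j hj)
  refine ⟨t, ?_, ?_⟩
  · have : t ∈ ({t} : Finset (ℕ × ℕ × ℕ)) := Finset.mem_singleton_self t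
    rw [← ht] at this
    exact Finset.mem_filter.1 this
  · intro u hu
    have : u ∈ sol.filter (fun t : ℕ × ℕ × ℕ =>
        t.1 ≤ i ∧ i < t.1 + t.2.2 ∧ t.2.1 ≤ j ∧ j < t.2.1 + t.2.2) := Finset.mem_filter.2 hu
    rw [ht] at this
    exact Finset.mem_singleton.1 this

end

end S17

theorem s_17 : s 17 = 12 := by
  apply le_antisymm
  · exact Nat.sInf_le ⟨S17.sol, S17.sol_tiling, by decide +kernel⟩
  · refine le_csInf ⟨12, S17.sol, S17.sol_tiling, by decide +kernel⟩ ?_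
    rintro k ⟨T, hT, rfl⟩
    exact S17.lower hT
end
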